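/- Let n ≥ 7. There is no permutation u_0 ∈ Sym_{2n} which is a product of two transpositions with disjoint supports and which commutes with (i, i+1)(n+i, n+i+1) for every 1 ≤ i ≤ n−1 with i ≠ 4. -/

import Mathlib

/-- The product of transpositions on values. -/
def case3_g (n i x : ℕ) : ℕ :=
  if x = i - 1 then i else if x = i then i - 1 else
  if x = n + i - 1 then n + i else if x = n + i then n + i - 1 else x

theorem case3_g_fix (n i x : ℕ) (h1 : 1 ≤ i) (h2 : i ≤ n - 1) :
    case3_g n i x = x ↔ ¬ (x = i - 1 ∨ x = i ∨ x = n + i - 1 ∨ x = n + i) := by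
  unfold case3_g
  split_ifs <;> omega

/-- Case 3 of the proof of Theorem 1. Let `n ≥ 7`. There is no
permutation `u₀ ∈ Sym_{2n}` which is a product of two transpositions with disjoint
supports and which commutes with `(i, i+1)(n+i, n+i+1)` for every `1 ≤ i ≤ n-1` with
`i ≠ 4` (1-based points; 0-based these are `(i-1, i)(n+i-1, n+i)`). -/
theorem case3_no_u0 (n : ℕ) (hn : 7 ≤ n) :
    ¬ ∃ (u0 : Equiv.Perm (Fin (2 * n))) (a b c d : Fin (2 * n)),
      a ≠ b ∧ c ≠ d ∧ a ≠ c ∧ a ≠ d ∧ b ≠ c ∧ b ≠ d ∧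
      u0 = Equiv.swap a b * Equiv.swap c d ∧
      ∀ (i : ℕ) (_h1 : 1 ≤ i) (_h2 : i ≤ n - 1), i ≠ 4 →
        Commute u0
          (Equiv.swap (⟨i - 1, by omega⟩ : Fin (2 * n)) ⟨i, by omega⟩ *
           Equiv.swap (⟨n + i - 1, by omega⟩ : Fin (2 * n)) ⟨n + i, by omega⟩) := by
  rintro ⟨u, a, b, c, d, hab, hcd, hac, had, hbc, hbd, hu, hc⟩
  have uval : ∀ x y : Fin (2 * n), u x = y → x ≠ y → (x = a ∧ y = b) ∨ (x = b ∧ y = a) ∨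
      (x = c ∧ y = d) ∨ (x = d ∧ y = c) := by
    intro x y h hne
    rw [hu, Equiv.Perm.mul_apply] at h
    simp only [Equiv.swap_apply_def] at h
    grind
  have ua : u a = b := by
    rw [hu, Equiv.Perm.mul_apply, Equiv.swap_apply_of_ne_of_ne hac had, Equiv.swap_apply_left]
  have ub : u b = a := by
    rw [hu, Equiv.Perm.mul_apply, Equiv.swap_apply_of_ne_of_ne hbc hbd, Equiv.swap_apply_right]
  -- the commuting permutations, on values
  have key : ∀ i : ℕ, 1 ≤ i → i ≤ n - 1 → i ≠ 4 → ∃ g : Fin (2 * n) → Fin (2 * n),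
      (∀ x, u (g x) = g (u x)) ∧ (∀ x, (g x).val = case3_g n i x.val) := by
    intro i h1 h2 h4
    refine ⟨_, fun x => Equiv.Perm.congr_fun (hc i h1 h2 h4).eq x, fun x => ?_⟩
    simp only [Equiv.Perm.mul_apply, Equiv.swap_apply_def, Fin.ext_iff, case3_g]
    split_ifs <;> dsimp only at * <;> omega
  have fixiff : ∀ i : ℕ, 1 ≤ i → i ≤ n - 1 → i ≠ 4 →
      (case3_g n i a.val = a.val ↔ case3_g n i b.val = b.val) := by
    intro i h1 h2 h4
    obtain ⟨g, hg, hv⟩ := key i h1 h2 h4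
    rw [← hv, ← hv, ← Fin.ext_iff, ← Fin.ext_iff]
    constructor
    · intro h
      have := hg a
      rw [h, ua] at this
      exact this.symm
    · intro h
      have := hg b
      rw [h, ub] at this
      exact this.symm
  have mv : ∀ i : ℕ, 1 ≤ i → i ≤ n - 1 → i ≠ 4 →
      ((a.val = i - 1 ∨ a.val = i ∨ a.val = n + i - 1 ∨ a.val = n + i) ↔
       (b.val = i - 1 ∨ b.val = i ∨ b.val = n + i - 1 ∨ b.val = n + i)) := by
    intro i h1 h2 h4
    have := fixiff i h1 h2 h4
    rw [case3_g_fix n i _ h1 h2, case3_g_fix n i _ h1 h2] at this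
    exact not_iff_not.mp this
  have step : ∀ i : ℕ, 1 ≤ i → i ≤ n - 1 → i ≠ 4 → ∀ x y : Fin (2 * n), u x = y →
      ∃ x' y' : Fin (2 * n), u x' = y' ∧ x'.val = case3_g n i x.val ∧
        y'.val = case3_g n i y.val := by
    intro i h1 h2 h4 x y h
    obtain ⟨g, hg, hv⟩ := key i h1 h2 h4
    exact ⟨g x, g y, by rw [hg, h], hv x, hv y⟩
  let P : ℕ → Prop := fun p => ∃ x y : Fin (2 * n), u x = y ∧ x.val = p ∧ y.val = p + n
  have up : ∀ p, p + 1 < n → p ≠ 3 → P p → P (p + 1) := by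
    rintro p hp h3 ⟨x, y, h, hx, hy⟩
    obtain ⟨x', y', h', hx', hy'⟩ := step (p + 1) (by omega) (by omega) (by omega) x y h
    refine ⟨x', y', h', ?_, ?_⟩
    · rw [hx', hx]; unfold case3_g; split_ifs <;> omega
    · rw [hy', hy]; unfold case3_g; split_ifs <;> omega
  have down : ∀ p, p + 1 < n → p ≠ 3 → P (p + 1) → P p := by
    rintro p hp h3 ⟨x, y, h, hx, hy⟩
    obtain ⟨x', y', h', hx', hy'⟩ := step (p + 1) (by omega) (by omega) (by omega) x y h
    refine ⟨x', y', h', ?_, ?_⟩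
    · rw [hx', hx]; unfold case3_g; split_ifs <;> omega
    · rw [hy', hy]; unfold case3_g; split_ifs <;> omega
  have no3 : ∀ p, P p → P (p + 1) → P (p + 2) → False := by
    have cs : ∀ p, P p → (a.val = p ∧ b.val = p + n) ∨ (b.val = p ∧ a.val = p + n) ∨
        (c.val = p ∧ d.val = p + n) ∨ (d.val = p ∧ c.val = p + n) := by
      rintro p ⟨x, y, h, hx, hy⟩
      rcases uval x y h (by intro e; rw [e] at hx; omega) with
        ⟨rfl, rfl⟩ | ⟨rfl, rfl⟩ | ⟨rfl, rfl⟩ | ⟨rfl, rfl⟩ <;> omega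
    intro p h0 h1 h2
    have := cs _ h0
    have := cs _ h1
    have := cs _ h2
    omega
  have fin : ∀ p, p < n → P p → False := by
    intro p hp h
    have A : ∀ q, q + 2 < n → q ≠ 3 → q ≠ 2 → P q → False := fun q h1 h2 h3 hq =>
      no3 q hq (up q (by omega) h2 hq)
        (up (q + 1) (by omega) (by omega) (up q (by omega) h2 hq))
    have B : ∀ q, q + 2 < n → q ≠ 3 → q ≠ 2 → P (q + 1) → False := fun q h1 h2 h3 hq =>
      A q h1 h2 h3 (down q (by omega) h2 hq)
    have C : ∀ q, q + 2 < n → q ≠ 3 → q ≠ 2 → P (q + 2) → False := fun q h1 h2 h3 hq =>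
      B q h1 h2 h3 (down (q + 1) (by omega) (by omega) hq)
    by_cases h1 : p < 2
    · exact A p (by omega) (by omega) (by omega) h
    · obtain ⟨q, rfl⟩ : ∃ q, p = q + 2 := ⟨p - 2, by omega⟩
      by_cases h2 : q = 2
      · subst h2; exact A 4 (by omega) (by omega) (by omega) h
      by_cases h3 : q = 3
      · subst h3; exact B 4 (by omega) (by omega) (by omega) h
      exact C q (by omega) h3 h2 h
  have hab' : a.val ≠ b.val := fun h => hab (Fin.ext h)
  have fin2 : b.val = a.val + n ∨ a.val = b.val + n := by
    have ha := a.isLt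
    have hb := b.isLt
    obtain ⟨p, hp, hpa⟩ : ∃ p, p < n ∧ (a.val = p ∨ a.val = n + p) := by
      by_cases h : a.val < n
      · exact ⟨a.val, h, Or.inl rfl⟩
      · exact ⟨a.val - n, by omega, by omega⟩
    obtain ⟨q, hq, hqb⟩ : ∃ q, q < n ∧ (b.val = q ∨ b.val = n + q) := by
      by_cases h : b.val < n
      · exact ⟨b.val, h, Or.inl rfl⟩
      · exact ⟨b.val - n, by omega, by omega⟩
    have mv' : ∀ i : ℕ, 1 ≤ i → i ≤ n - 1 → i ≠ 4 → ((p = i - 1 ∨ p = i) ↔ (q = i - 1 ∨ q = i)) := by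
      intro i h1 h2 h4
      have := mv i h1 h2 h4
      omega
    have hpq : p = q := by
      have e1 := mv' p
      have e2 := mv' (p + 1)
      have e3 := mv' q
      have e4 := mv' (q + 1)
      omega
    omega
  rcases fin2 with h | h
  · exact fin a.val (by have := b.isLt; omega) ⟨a, b, ua, rfl, h⟩
  · exact fin b.val (by have := a.isLt; omega) ⟨b, a, ub, rfl, h⟩
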